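/- For every integer k with 4 ≤ k ≤ 6, there is a 5-clause Achlioptas rule for random k-SAT (namely: select the first among the first 4 presented clauses that contains at least two positive literals, and otherwise select the 5th clause) such that the formula Φ_m generated after m = ⌈2^k·(ln 2)·n⌉ steps is satisfiable with probability tending to 1 as n → ∞. -/

import Mathlib

open Finset Filter

/-- A literal over `n` variables: a variable together with a sign (`true` = positive). -/
abbrev Lit (n : ℕ) := Fin n × Bool

/-- A `k`-clause over `n` variables: a set of `k` literals on `k` distinct variables.
There are `C(n,k) * 2^k` such clauses. -/
abbrev Clause (n k : ℕ) :=
  {C : Finset (Lit n) // C.card = k ∧ (C.image Prod.fst).card = k}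

/-- The number of positive literals in a clause. -/
def Clause.posCount {n k : ℕ} (C : Clause n k) : ℕ :=
  (C.1.filter fun p => p.2 = true).card

/-- The assignment `σ` satisfies the clause `C`. -/
def Sat {n k : ℕ} (σ : Fin n → Bool) (C : Clause n k) : Prop :=
  ∃ p ∈ C.1, σ p.1 = p.2

/-- A formula (a finite sequence of clauses) is satisfiable. -/
def Satisfiable {n k m : ℕ} (Φ : Fin m → Clause n k) : Prop :=
  ∃ σ : Fin n → Bool, ∀ i, Sat σ (Φ i)

/-- The Achlioptas rule: select the first among the first `l - 1` presented clauses
containing at least two positive literals; if there is none, select the `l`-th clause. -/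
def select {n k l : ℕ} (hl : 0 < l) (cs : Fin l → Clause n k) : Clause n k :=
  match (List.finRange l).find? (fun i => decide (i.1 + 1 < l ∧ 2 ≤ (cs i).posCount)) with
  | some i => cs i
  | none => cs ⟨l - 1, Nat.sub_lt hl one_pos⟩

/-- The probability of the event `P` under the uniform distribution on the finite type `α`;
in particular, for `α = Fin m → Fin l → Clause n k` this is the probability that `P` holds
for `m` rounds of `l` clauses drawn independently and uniformly at random with replacement. -/
noncomputable def unifProb {α : Type*} [Fintype α] (P : α → Prop) : ℝ :=
  (Nat.card {a // P a} : ℝ) / (Fintype.card α : ℝ)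


section TwoSat
variable {V : Type*}

def lneg (x : V × Bool) : V × Bool := (x.1, !x.2)

lemma lneg_lneg (x : V × Bool) : lneg (lneg x) = x := by simp [lneg]

def Imp (E : Bool → V → V → Prop) (x y : V × Bool) : Prop := y.2 = (!x.2) ∧ E x.2 x.1 y.1

lemma Imp.skew {E : Bool → V → V → Prop} (hs : ∀ b v u, E b v u → E b u v) {x y : V × Bool}
    (h : Imp E x y) : Imp E (lneg y) (lneg x) := by
  obtain ⟨h1, h2⟩ := h
  refine ⟨by simp [lneg, h1], ?_⟩
  simp only [lneg, h1, Bool.not_not]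
  exact hs _ _ _ h2

lemma Imp.skew_rtg {E : Bool → V → V → Prop} (hs : ∀ b v u, E b v u → E b u v) {x y : V × Bool}
    (h : Relation.ReflTransGen (Imp E) x y) : Relation.ReflTransGen (Imp E) (lneg y) (lneg x) := by
  induction h with
  | refl => exact .refl
  | tail _ h ih => exact .head (h.skew hs) ih

lemma two_sat [Finite V] {E : Bool → V → V → Prop} (hs : ∀ b v u, E b v u → E b u v) :
    (∃ σ : V → Bool, ∀ b v u, E b v u → ¬ (σ v = b ∧ σ u = b)) ∨
    ∃ x, Relation.ReflTransGen (Imp E) x (lneg x) ∧ Relation.ReflTransGen (Imp E) (lneg x) x := by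
  let P : Set (V × Bool) → Prop := fun S => (∀ x ∈ S, ∀ y, Imp E x y → y ∈ S) ∧ ∀ x ∈ S, lneg x ∉ S
  have hP0 : P ∅ := by simp [P]
  obtain ⟨S, -, hS⟩ := (Set.toFinite {S | P S}).exists_le_maximal (a := ∅) hP0
  have hSP : P S := hS.prop
  have hcl : ∀ x ∈ S, ∀ y, Relation.ReflTransGen (Imp E) x y → y ∈ S := by
    intro x hx y h
    induction h with
    | refl => exact hx
    | tail _ h ih => exact hSP.1 _ ih _ h
  have key : ∀ x, x ∉ S → lneg x ∉ S → Relation.ReflTransGen (Imp E) x (lneg x) := by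
    intro x h1 h2
    by_contra hno
    have hP' : P (S ∪ {y | Relation.ReflTransGen (Imp E) x y}) := by
      constructor
      · rintro a (ha | ha) b hab
        · exact Or.inl (hSP.1 a ha b hab)
        · exact Or.inr (Relation.ReflTransGen.tail ha hab)
      · rintro y (hy | hy) (hy' | hy')
        · exact hSP.2 y hy hy'
        · have := Imp.skew_rtg hs hy'
          rw [lneg_lneg] at this
          exact h2 (hcl _ hy _ this)
        · exact h2 (hcl _ hy' _ (Imp.skew_rtg hs hy))
        · have := Imp.skew_rtg hs hy'
          rw [lneg_lneg] at this
          exact hno (Relation.ReflTransGen.trans hy this)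
    have := hS.le_of_ge hP' Set.subset_union_left
    exact h1 (this (Or.inr Relation.ReflTransGen.refl))
  by_cases hall : ∀ x, x ∈ S ∨ lneg x ∈ S
  · left
    classical
    refine ⟨fun v => decide ((v, true) ∈ S), ?_⟩
    have hσ : ∀ v b, decide ((v, true) ∈ S) = b → (v, b) ∈ S := by
      intro v b hb
      cases b
      · have h := hall (v, true)
        simp at hb
        rcases h with h | h
        · exact absurd h hb
        · simpa [lneg] using h
      · simpa using hb
    rintro b v u hE ⟨hv, hu⟩
    have h1 := hσ v b hv
    have h2 := hσ u b hu
    have h3 : (u, !b) ∈ S := hSP.1 _ h1 (u, !b) ⟨rfl, hE⟩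
    exact hSP.2 _ h2 h3
  · right
    push Not at hall
    obtain ⟨x, h1, h2⟩ := hall
    refine ⟨x, key x h1 h2, ?_⟩
    have := key (lneg x) h2 (by rwa [lneg_lneg])
    rwa [lneg_lneg] at this

lemma rtg_walk {α : Type*} {R : α → α → Prop} {x y : α} (h : Relation.ReflTransGen R x y)
    (w : ℕ → α) (hw0 : w 0 = y) (hw : ∀ i, R (w i) (w (i+1))) :
    ∃ (j : ℕ) (z : ℕ → α), z 0 = x ∧ z j = y ∧ ∀ i, R (z i) (z (i+1)) := by
  induction h using Relation.ReflTransGen.head_induction_on with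
  | refl => exact ⟨0, w, hw0, hw0, hw⟩
  | @head a c h _ ih =>
    obtain ⟨j, z, h0, hj, hz⟩ := ih
    refine ⟨j+1, fun i => Nat.casesOn i a z, rfl, hj, ?_⟩
    rintro (_ | i)
    · simpa [h0] using h
    · exact hz i

lemma scc_walk {α : Type*} {R : α → α → Prop} {x y : α} (hne : x ≠ y)
    (h : Relation.ReflTransGen R x y) (h' : Relation.ReflTransGen R y x) :
    ∃ w : ℕ → α, w 0 = y ∧ ∀ i, R (w i) (w (i+1)) := by
  let C := {a // Relation.ReflTransGen R y a ∧ Relation.ReflTransGen R a y}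
  have hsucc : ∀ a : C, ∃ b : C, R a.1 b.1 := by
    rintro ⟨a, ha1, ha2⟩
    by_cases hay : a = y
    · subst hay
      rcases Relation.ReflTransGen.cases_head h' with h0 | ⟨c, hc, hcx⟩
      · exact absurd h0.symm hne
      · exact ⟨⟨c, .single hc, hcx.trans h⟩, hc⟩
    · rcases Relation.ReflTransGen.cases_head ha2 with h0 | ⟨c, hc, hcx⟩
      · exact absurd h0 hay
      · exact ⟨⟨c, ha1.tail hc, hcx⟩, hc⟩
  choose f hf using hsucc
  refine ⟨fun i => (f^[i] ⟨y, .refl, .refl⟩).1, rfl, fun i => ?_⟩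
  simp only [Function.iterate_succ_apply']
  exact hf _

/-- tadpole structure -/
lemma tadpole [Fintype V] {E : Bool → V → V → Prop} (hs : ∀ b v u, E b v u → E b u v)
    (hno : ¬ ∃ σ : V → Bool, ∀ b v u, E b v u → ¬ (σ v = b ∧ σ u = b)) :
    ∃ (L j e : ℕ) (z : ℕ → V × Bool), L ≤ Fintype.card V ∧ 0 < j ∧ j ≤ L ∧ e ≤ L ∧
      z j = lneg (z 0) ∧ (z (L+1)).1 = (z e).1 ∧ (∀ i, Imp E (z i) (z (i+1))) ∧
      ∀ i i', i < i' → i' ≤ L → (z i).1 = (z i').1 → i = 0 ∧ i' = j := by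
  classical
  obtain ⟨x, hx1, hx2⟩ := (two_sat hs).resolve_left hno
  have hne : x ≠ lneg x := by
    intro h
    have := congrArg Prod.snd h
    simp [lneg] at this
  obtain ⟨w, hw0, hw⟩ := scc_walk hne hx1 hx2
  obtain ⟨j0, z0, h00, h0j, hz0⟩ := rtg_walk hx1 w hw0 hw
  have hex : ∃ j, ∃ z : ℕ → V × Bool, z j = lneg (z 0) ∧ ∀ i, Imp E (z i) (z (i+1)) :=
    ⟨j0, z0, by rw [h0j, h00], hz0⟩
  obtain ⟨z, hzj, hz⟩ := Nat.find_spec hex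
  have hmin := fun {j} => Nat.find_min hex (m := j)
  set j := Nat.find hex with hj
  clear_value j
  have hjpos : 0 < j := by
    rcases Nat.eq_zero_or_pos j with h | h
    · subst h
      have := congrArg Prod.snd hzj
      simp [lneg] at this
    · exact h
  have hinj : ∀ p q, p < q → q < j → (z p).1 ≠ (z q).1 := by
    intro p q hpq hqj heq
    by_cases h2 : (z p).2 = (z q).2
    · have hpqe : z p = z q := Prod.ext heq h2
      refine hmin (j := j - (q - p)) (by omega) ⟨fun t => if t ≤ p then z t else z (t + (q-p)), ?_, ?_⟩
      · have h1 : ¬ (j - (q - p) ≤ p) := by omega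
        have h3 : j - (q - p) + (q - p) = j := by omega
        simp [h1, h3, hzj]
      · intro i
        rcases lt_trichotomy i p with h | h | h
        · simp [h.le, Nat.succ_le_of_lt h, hz]
        · subst h
          simp only [le_refl, if_true]
          rw [if_neg (by omega), hpqe, show i + 1 + (q - i) = q + 1 by omega]
          exact hz q
        · simp only
          rw [if_neg (by omega), if_neg (by omega), show i + 1 + (q - p) = i + (q-p) + 1 by omega]
          exact hz _
    · refine hmin (j := q - p) (by omega) ⟨fun t => z (p + t), ?_, ?_⟩
      · simp only [add_zero]
        rw [show p + (q - p) = q by omega]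
        refine Prod.ext heq.symm ?_
        simp only [lneg]
        revert h2
        cases (z p).2 <;> cases (z q).2 <;> simp
      · intro i
        exact hz _
  have hexL : ∃ L, j ≤ L ∧ ∃ e ≤ L, (z (L+1)).1 = (z e).1 := by
    by_contra hcon
    push Not at hcon
    have : Function.Injective (fun t : ℕ => (z (j + 1 + t)).1) := by
      intro s t hst
      by_contra hne'
      rcases lt_or_gt_of_ne hne' with h | h
      · refine hcon (j + t) (by omega) (j + 1 + s) (by omega) ?_
        rw [show j + t + 1 = j + 1 + t by omega]
        exact hst.symm
      · refine hcon (j + s) (by omega) (j + 1 + t) (by omega) ?_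
        rw [show j + s + 1 = j + 1 + s by omega]
        exact hst
    exact not_injective_infinite_finite _ this
  obtain ⟨hjL, e, heL, hLe⟩ := Nat.find_spec hexL
  have hminL := fun {L} => Nat.find_min hexL (m := L)
  set L := Nat.find hexL with hL
  clear_value L
  have hfin : ∀ i i', i < i' → i' ≤ L → (z i).1 = (z i').1 → i = 0 ∧ i' = j := by
    intro i i' hii hiL heq
    rcases lt_trichotomy i' j with h | h | h
    · exact absurd heq (hinj _ _ hii h)
    · subst h
      refine ⟨?_, rfl⟩
      by_contra hi0
      refine hinj 0 i (by omega) hii ?_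
      rw [heq, hzj]; rfl
    · exfalso
      refine hminL (L := i' - 1) (by omega) ⟨by omega, i, by omega, ?_⟩
      rw [show i' - 1 + 1 = i' by omega, heq]
  refine ⟨L, j, e, z, ?_, hjpos, hjL, heL, hzj, hLe, hz, hfin⟩
  have : Function.Injective (fun t : Fin L => (z (t.1+1)).1) := by
    intro s t hst
    by_contra hne'
    rcases lt_or_gt_of_ne hne' with h | h
    · have := hfin (s.1+1) (t.1+1) (by simpa using h) (by omega) hst
      omega
    · have := hfin (t.1+1) (s.1+1) (by simpa using h) (by omega) hst.symm
      omega
  simpa using Fintype.card_le_of_injective _ this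

end TwoSat

section Counting

lemma emb_count {d k n : ℕ} (p : Fin d ↪ Fin k) (x : Fin d ↪ Fin n) :
    (univ.filter (fun f : Fin k ↪ Fin n => ∀ i, f (p i) = x i)).card * n.descFactorial d
      ≤ Fintype.card (Fin k ↪ Fin n) := by
  classical
  have htr : ∀ y : Fin d ↪ Fin n, ∃ g : Equiv.Perm (Fin n), g • x = y := fun y =>
    Equiv.Perm.exists_smul_eq_embedding x y
  choose g hg using htr
  have hg' : ∀ y i, g y (x i) = y i := by
    intro y i
    have := DFunLike.congr_fun (hg y) i
    simpa using this
  have hcard : n.descFactorial d = (univ : Finset (Fin d ↪ Fin n)).card := by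
    simp [Fintype.card_embedding_eq]
  rw [hcard, ← card_product, ← card_univ]
  refine card_le_card_of_injOn (fun q => q.1.trans (g q.2).toEmbedding) (by simp) ?_
  rintro ⟨f, y⟩ hf ⟨f', y'⟩ hf' h
  simp only [coe_product, coe_filter, Set.mem_prod, Set.mem_ofPred_eq, mem_univ, true_and] at hf hf'
  have h1 : ∀ i, g y (f i) = g y' (f' i) := fun i => DFunLike.congr_fun h i
  have hy : y = y' := by
    ext i
    have := h1 (p i)
    rw [hf.1, hf'.1, hg', hg'] at this
    rw [this]
  subst hy
  have : f = f' := by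
    ext i
    have := (g y).injective (h1 i)
    rw [this]
  rw [this]

lemma pair_count {k n : ℕ} {a b : Fin k} (hab : a ≠ b) (x y : Fin n) :
    ((univ.filter (fun f : Fin k ↪ Fin n => f a = x ∧ f b = y)).card : ℝ) * (n * (n - 1))
      ≤ Fintype.card (Fin k ↪ Fin n) := by
  classical
  by_cases hxy : x = y
  · have : (univ.filter (fun f : Fin k ↪ Fin n => f a = x ∧ f b = y)) = ∅ := by
      refine filter_eq_empty_iff.mpr ?_
      rintro f - ⟨h1, h2⟩
      exact hab (f.injective (by rw [h1, h2, hxy]))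
    rw [this]; simp
  · have h := emb_count (d := 2) (k := k) (n := n) ⟨![a, b], by
      intro i j; fin_cases i <;> fin_cases j <;> simp [hab, hab.symm]⟩ ⟨![x, y], by
      intro i j; fin_cases i <;> fin_cases j <;> simp [hxy, Ne.symm hxy]⟩
    simp only [Function.Embedding.coeFn_mk, Fin.forall_fin_two, Matrix.cons_val_zero,
      Matrix.cons_val_one] at h
    have hn : ((n.descFactorial 2 : ℕ) : ℝ) = n * (n - 1) := by
      rcases n with _ | n
      · simp
      · simp [Nat.descFactorial]; ring
    rw [← hn]
    exact_mod_cast h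

lemma triple_count {k n : ℕ} {a b c : Fin k} (hab : a ≠ b) (hac : a ≠ c) (hbc : b ≠ c)
    (x y z : Fin n) :
    ((univ.filter (fun f : Fin k ↪ Fin n => f a = x ∧ f b = y ∧ f c = z)).card : ℝ)
      * (n * (n - 1) * (n - 2)) ≤ Fintype.card (Fin k ↪ Fin n) := by
  classical
  by_cases hxy : x = y ∨ x = z ∨ y = z
  · have : (univ.filter (fun f : Fin k ↪ Fin n => f a = x ∧ f b = y ∧ f c = z)) = ∅ := by
      refine filter_eq_empty_iff.mpr ?_
      rintro f - ⟨h1, h2, h3⟩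
      rcases hxy with h | h | h
      · exact hab (f.injective (by rw [h1, h2, h]))
      · exact hac (f.injective (by rw [h1, h3, h]))
      · exact hbc (f.injective (by rw [h2, h3, h]))
    rw [this]; simp
  · push Not at hxy
    obtain ⟨h1, h2, h3⟩ := hxy
    have h := emb_count (d := 3) (k := k) (n := n) ⟨![a, b, c], by
      intro i j; fin_cases i <;> fin_cases j <;> simp [hab, hab.symm, hac, hac.symm, hbc, hbc.symm]⟩
      ⟨![x, y, z], by
      intro i j; fin_cases i <;> fin_cases j <;> simp [h1, h1.symm, h2, h2.symm, h3, h3.symm]⟩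
    simp only [Function.Embedding.coeFn_mk, Fin.forall_fin_succ, Fin.isValue, Matrix.cons_val_zero,
      Matrix.cons_val_succ, Fin.succ_zero_eq_one, Fin.forall_fin_zero, and_true, Matrix.cons_val_one,
      Matrix.cons_val_fin_one] at h
    have hn : ((n.descFactorial 3 : ℕ) : ℝ) = n * (n - 1) * (n - 2) := by
      rcases n with _ | _ | n
      · simp
      · simp [Nat.descFactorial]
      · simp [Nat.descFactorial]; ring
    rw [← hn]
    exact_mod_cast h

lemma card_pi_le {I E : Type*} [Fintype I] [DecidableEq I] [Fintype E] [DecidableEq E]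
    (T : I → Prop) [DecidablePred T] (X0 : I → Finset E) (X : ({i // T i} → E) → I → Finset E)
    (c : I → ℝ) (hc : ∀ i, 0 ≤ c i) (h0 : ∀ i, T i → ((X0 i).card : ℝ) ≤ c i)
    (h1 : ∀ F i, ¬ T i → ((X F i).card : ℝ) ≤ c i) :
    ((univ.filter (fun F : I → E => (∀ i, T i → F i ∈ X0 i) ∧
      ∀ i, ¬ T i → F i ∈ X (fun i => F i.1) i)).card : ℝ) ≤ ∏ i, c i := by
  have hle : (univ.filter (fun F : I → E => (∀ i, T i → F i ∈ X0 i) ∧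
      ∀ i, ¬ T i → F i ∈ X (fun i => F i.1) i)).card ≤
      ((Fintype.piFinset (fun i : {i // T i} => X0 i)).sigma
        (fun F1 => Fintype.piFinset fun i : {i // ¬ T i} => X F1 i)).card := by
    refine card_le_card_of_injOn (fun F => ⟨fun i => F i.1, fun i => F i.1⟩) ?_ ?_
    · intro F hF
      simp only [coe_filter, mem_univ, true_and, Set.mem_ofPred_eq] at hF
      simp only [coe_sigma, Set.mem_sigma_iff, mem_coe, Fintype.mem_piFinset]
      exact ⟨fun i => hF.1 _ i.2, fun i => hF.2 _ i.2⟩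
    · intro F _ F' _ h
      simp only [Sigma.mk.injEq, heq_eq_eq] at h
      funext i
      by_cases hi : T i
      · exact congrFun h.1 ⟨i, hi⟩
      · exact congrFun h.2 ⟨i, hi⟩
  calc _ ≤ ((((Fintype.piFinset (fun i : {i // T i} => X0 i)).sigma
        (fun F1 => Fintype.piFinset fun i : {i // ¬ T i} => X F1 i)).card : ℕ) : ℝ) := by
        exact_mod_cast hle
    _ = ∑ F1 ∈ Fintype.piFinset (fun i : {i // T i} => X0 i),
          ∏ i : {i // ¬ T i}, ((X F1 i).card : ℝ) := by
        rw [card_sigma]; simp [Fintype.card_piFinset]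
    _ ≤ ∑ F1 ∈ Fintype.piFinset (fun i : {i // T i} => X0 i), ∏ i : {i // ¬ T i}, c i := by
        refine sum_le_sum fun F1 _ => prod_le_prod (fun _ _ => by positivity) fun i _ => h1 _ _ i.2
    _ = (∏ i : {i // T i}, ((X0 i).card : ℝ)) * ∏ i : {i // ¬ T i}, c i := by
        simp [Fintype.card_piFinset]
    _ ≤ (∏ i : {i // T i}, c i) * ∏ i : {i // ¬ T i}, c i := by
        refine mul_le_mul_of_nonneg_right
          (prod_le_prod (fun _ _ => by positivity) fun i _ => h0 _ i.2) ?_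
        exact prod_nonneg fun i _ => hc i
    _ = ∏ i, c i := by
        exact Fintype.prod_subtype_mul_prod_subtype T c

end Counting

section Main
variable {m n k : ℕ}

/-- variables covered by the chosen negative pairs -/
def wset (T : Fin m → Bool) (a b : Fin m → Fin k)
    (F : {i // T i = true} → (Fin k ↪ Fin n)) : Finset (Fin n) :=
  univ.image (fun i => F i (a i)) ∪ univ.image (fun i => F i (b i))

def pmt (a b : Fin k) (f : Fin k ↪ Fin n) (v u : Fin n) : Prop :=
  (f a = v ∧ f b = u) ∨ (f a = u ∧ f b = v)

def stepOk (T H : Fin m → Bool) (a b c : Fin m → Fin k) (F : Fin m → (Fin k ↪ Fin n))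
    (β : Bool) (v u : Fin n) (i : Fin m) : Prop :=
  T i = β ∧ pmt (a i) (b i) (F i) v u ∧
    (T i = false → H i = true → F i (c i) ∈ wset T a b (fun i => F i.1))

def edgeG (T H : Fin m → Bool) (a b c : Fin m → Fin k) (F : Fin m → (Fin k ↪ Fin n))
    (β : Bool) (v u : Fin n) : Prop := ∃ i, stepOk T H a b c F β v u i

def goodF (T H : Fin m → Bool) (a b c : Fin m → Fin k) (F : Fin m → (Fin k ↪ Fin n)) : Prop :=
  ∃ σ : Fin n → Bool, ∀ β v u, edgeG T H a b c F β v u → ¬ (σ v = β ∧ σ u = β)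

def ty (β : Bool) (l : ℕ) : Bool := xor β (Nat.bodd l)

noncomputable def gw (T H : Fin m → Bool) (n : ℕ) (β : Bool) (i : Fin m) : ℝ :=
  if T i = β then
    (if T i = false ∧ H i = true then
      2 * (2 * (univ.filter (fun i => T i = true)).card : ℕ) / (n * (n - 1) * (n - 2))
     else 2 / (n * (n - 1)))
  else 0

lemma gw_nonneg (T H : Fin m → Bool) (hn : 3 ≤ n) (β : Bool) (i : Fin m) : 0 ≤ gw T H n β i := by
  have h3 : (3 : ℝ) ≤ n := by exact_mod_cast hn
  have h1 : (0:ℝ) < n - 1 := by linarith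
  have h2 : (0:ℝ) < n - 2 := by linarith
  unfold gw
  split_ifs <;> positivity

lemma wset_card (T : Fin m → Bool) (a b : Fin m → Fin k)
    (F : {i // T i = true} → (Fin k ↪ Fin n)) :
    (wset T a b F).card ≤ 2 * (univ.filter (fun i => T i = true)).card := by
  refine (card_union_le _ _).trans ?_
  have h : (univ : Finset {i // T i = true}).card = (univ.filter (fun i => T i = true)).card := by
    rw [card_univ, Fintype.card_subtype]
  have h1 := card_image_le (s := univ) (f := fun i : {i // T i = true} => F i (a i))
  have h2 := card_image_le (s := univ) (f := fun i : {i // T i = true} => F i (b i))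
  omega

open Classical in
lemma mt_count {a b : Fin k} (hab : a ≠ b) (hn : 3 ≤ n) (x y : Fin n) :
    ((univ.filter (fun f : Fin k ↪ Fin n => pmt a b f x y)).card : ℝ)
      ≤ Fintype.card (Fin k ↪ Fin n) * (2 / (n * (n - 1))) := by
  have h3 : (3 : ℝ) ≤ n := by exact_mod_cast hn
  have h1 : (0:ℝ) < n * (n - 1) := by nlinarith
  have hA := pair_count (n := n) hab x y
  have hB := pair_count (n := n) hab y x
  have hle : (univ.filter (fun f : Fin k ↪ Fin n => pmt a b f x y)).card ≤
      (univ.filter (fun f : Fin k ↪ Fin n => f a = x ∧ f b = y)).card +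
      (univ.filter (fun f : Fin k ↪ Fin n => f a = y ∧ f b = x)).card := by
    refine (card_le_card ?_).trans (card_union_le _ _)
    intro f hf
    have hf' : pmt a b f x y := (mem_filter.mp hf).2
    rcases hf' with h | h
    · exact mem_union_left _ (mem_filter.mpr ⟨mem_univ _, h⟩)
    · exact mem_union_right _ (mem_filter.mpr ⟨mem_univ _, h⟩)
  have hle' : ((univ.filter (fun f : Fin k ↪ Fin n => pmt a b f x y)).card : ℝ) ≤
      (univ.filter (fun f : Fin k ↪ Fin n => f a = x ∧ f b = y)).card +
      (univ.filter (fun f : Fin k ↪ Fin n => f a = y ∧ f b = x)).card := by exact_mod_cast hle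
  rw [← mul_div_assoc, le_div_iff₀ h1]
  nlinarith

open Classical in
lemma mt_count3 {a b c : Fin k} (hab : a ≠ b) (hac : a ≠ c) (hbc : b ≠ c) (hn : 3 ≤ n)
    (x y : Fin n) (W : Finset (Fin n)) (w : ℕ) (hw : W.card ≤ w) :
    ((univ.filter (fun f : Fin k ↪ Fin n => pmt a b f x y ∧ f c ∈ W)).card : ℝ)
      ≤ Fintype.card (Fin k ↪ Fin n) * (2 * w / (n * (n - 1) * (n - 2))) := by
  have h3 : (3 : ℝ) ≤ n := by exact_mod_cast hn
  have h1 : (0:ℝ) < n * (n - 1) * (n - 2) := by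
    have : (0:ℝ) < n - 1 := by linarith
    have : (0:ℝ) < n - 2 := by linarith
    positivity
  have hle : (univ.filter (fun f : Fin k ↪ Fin n => pmt a b f x y ∧ f c ∈ W)).card ≤
      ∑ z ∈ W, ((univ.filter (fun f : Fin k ↪ Fin n => f a = x ∧ f b = y ∧ f c = z)).card +
      (univ.filter (fun f : Fin k ↪ Fin n => f a = y ∧ f b = x ∧ f c = z)).card) := by
    refine le_trans (card_le_card (t := W.biUnion fun z =>
      (univ.filter (fun f : Fin k ↪ Fin n => f a = x ∧ f b = y ∧ f c = z)) ∪
      (univ.filter (fun f : Fin k ↪ Fin n => f a = y ∧ f b = x ∧ f c = z))) ?_)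
      (card_biUnion_le.trans (sum_le_sum fun z _ => card_union_le _ _))
    intro f hf
    have hf' : pmt a b f x y ∧ f c ∈ W := (mem_filter.mp hf).2
    simp only [mem_filter, mem_univ, true_and, mem_biUnion, mem_union]
    obtain ⟨h | h, hc⟩ := hf'
    · exact ⟨_, hc, Or.inl ⟨h.1, h.2, rfl⟩⟩
    · exact ⟨_, hc, Or.inr ⟨h.1, h.2, rfl⟩⟩
  have hle' : ((univ.filter (fun f : Fin k ↪ Fin n => pmt a b f x y ∧ f c ∈ W)).card : ℝ) ≤
      ∑ z ∈ W, (((univ.filter (fun f : Fin k ↪ Fin n => f a = x ∧ f b = y ∧ f c = z)).card : ℝ) +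
      ((univ.filter (fun f : Fin k ↪ Fin n => f a = y ∧ f b = x ∧ f c = z)).card : ℝ)) := by
    exact_mod_cast hle
  rw [← mul_div_assoc, le_div_iff₀ h1]
  calc _ ≤ (∑ z ∈ W, (((univ.filter (fun f : Fin k ↪ Fin n => f a = x ∧ f b = y ∧ f c = z)).card : ℝ)
        + ((univ.filter (fun f : Fin k ↪ Fin n => f a = y ∧ f b = x ∧ f c = z)).card : ℝ)))
        * (n * (n - 1) * (n - 2)) := mul_le_mul_of_nonneg_right hle' h1.le
    _ ≤ ∑ z ∈ W, (2 * (Fintype.card (Fin k ↪ Fin n) : ℝ)) := by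
        rw [sum_mul]
        refine sum_le_sum fun z _ => ?_
        have hA := triple_count (n := n) hab hac hbc x y z
        have hB := triple_count (n := n) hab hac hbc y x z
        rw [add_mul]; linarith
    _ = W.card * (2 * (Fintype.card (Fin k ↪ Fin n) : ℝ)) := by simp
    _ ≤ w * (2 * (Fintype.card (Fin k ↪ Fin n) : ℝ)) := by
        refine mul_le_mul_of_nonneg_right ?_ (by positivity)
        exact_mod_cast hw
    _ = _ := by ring

open Classical in
lemma ev_bound (T H : Fin m → Bool) (a b c : Fin m → Fin k) (hab : ∀ i, a i ≠ b i)
    (hac : ∀ i, a i ≠ c i) (hbc : ∀ i, b i ≠ c i) (hn : 3 ≤ n) (L : ℕ) (β : Bool)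
    (y : Fin (L+2) → Fin n) (t : Fin (L+1) → Fin m) (ht : Function.Injective t) :
    ((univ.filter (fun F : Fin m → (Fin k ↪ Fin n) => ∀ l : Fin (L+1),
      stepOk T H a b c F (ty β l) (y l.castSucc) (y l.succ) (t l))).card : ℝ) ≤
      (Fintype.card (Fin k ↪ Fin n) : ℝ) ^ m * ∏ l : Fin (L+1), gw T H n (ty β l) (t l) := by
  set ce : ℝ := (Fintype.card (Fin k ↪ Fin n) : ℝ) with hce
  let X0 : Fin m → Finset (Fin k ↪ Fin n) := fun i => univ.filter fun f => ∀ l, t l = i →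
    T i = ty β l ∧ pmt (a i) (b i) f (y l.castSucc) (y l.succ)
  let X : ({i // T i = true} → (Fin k ↪ Fin n)) → Fin m → Finset (Fin k ↪ Fin n) :=
    fun F i => univ.filter fun f => ∀ l, t l = i →
    T i = ty β l ∧ pmt (a i) (b i) f (y l.castSucc) (y l.succ) ∧ (H i = true → f (c i) ∈ wset T a b F)
  let cc : Fin m → ℝ := fun i => ce * ∏ l with t l = i, gw T H n (ty β l) i
  have hcc : ∀ i, 0 ≤ cc i := fun i => mul_nonneg (by positivity)
    (prod_nonneg fun l _ => gw_nonneg T H hn _ _)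
  have hfil : ∀ l, (univ.filter fun l' => t l' = t l) = {l} := by
    intro l; ext l'; simp [ht.eq_iff]
  have hfil0 : ∀ i, (¬ ∃ l, t l = i) → cc i = ce := by
    intro i hi
    have : (univ.filter fun l' => t l' = i) = ∅ := by
      refine filter_eq_empty_iff.mpr fun l _ h => hi ⟨l, h⟩
    simp [cc, this]
  have hcle : ∀ S : Finset (Fin k ↪ Fin n), (S.card : ℝ) ≤ ce := by
    intro S
    have := card_le_univ S
    rw [hce]
    exact_mod_cast this
  have h0 : ∀ i, T i = true → ((X0 i).card : ℝ) ≤ cc i := by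
    intro i hi
    by_cases hl : ∃ l, t l = i
    · obtain ⟨l, rfl⟩ := hl
      simp only [cc, hfil, prod_singleton]
      by_cases hT : T (t l) = ty β l
      · rw [gw, if_pos hT, if_neg (by simp [hi])]
        refine le_trans ?_ (mt_count (hab (t l)) hn (y l.castSucc) (y l.succ))
        refine Nat.cast_le.mpr (card_le_card ?_)
        intro f hf
        simp only [X0, mem_filter, mem_univ, true_and] at hf ⊢
        exact (hf l rfl).2
      · have : X0 (t l) = ∅ := filter_eq_empty_iff.mpr fun f _ h => hT (h l rfl).1
        rw [this]
        simpa [cc, hfil] using hcc (t l)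
    · rw [hfil0 i hl]; exact hcle _
  have h1 : ∀ F i, ¬ T i = true → ((X F i).card : ℝ) ≤ cc i := by
    intro F i hi
    by_cases hl : ∃ l, t l = i
    · obtain ⟨l, rfl⟩ := hl
      simp only [cc, hfil, prod_singleton]
      by_cases hT : T (t l) = ty β l
      · rw [gw, if_pos hT]
        split_ifs with hH
        · refine le_trans ?_ (mt_count3 (hab (t l)) (hac (t l)) (hbc (t l)) hn (y l.castSucc) (y l.succ)
            (wset T a b F) _ (wset_card T a b F))
          refine Nat.cast_le.mpr (card_le_card ?_)
          intro f hf
          simp only [X, mem_filter, mem_univ, true_and] at hf ⊢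
          exact ⟨(hf l rfl).2.1, (hf l rfl).2.2 hH.2⟩
        · refine le_trans ?_ (mt_count (hab (t l)) hn (y l.castSucc) (y l.succ))
          refine Nat.cast_le.mpr (card_le_card ?_)
          intro f hf
          simp only [X, mem_filter, mem_univ, true_and] at hf ⊢
          exact (hf l rfl).2.1
      · have : X F (t l) = ∅ := filter_eq_empty_iff.mpr fun f _ h => hT (h l rfl).1
        rw [this]
        simpa [cc, hfil] using hcc (t l)
    · rw [hfil0 i hl]; exact hcle _
  have key := card_pi_le (fun i => T i = true) X0 X cc hcc h0 h1
  have hprod : ∏ i, cc i = ce ^ m * ∏ l : Fin (L+1), gw T H n (ty β l) (t l) := by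
    simp only [cc]
    rw [prod_mul_distrib, ← prod_fiberwise univ t (fun l => gw T H n (ty β l) (t l))]
    congr 1
    · simp
    · refine prod_congr rfl fun i _ => prod_congr rfl fun l hl => ?_
      rw [(mem_filter.mp hl).2]
  rw [← hprod]
  refine le_trans ?_ key
  refine Nat.cast_le.mpr (card_le_card ?_)
  intro F hF
  simp only [mem_filter, mem_univ, true_and, X0, X] at hF ⊢
  constructor
  · rintro i hi l rfl
    exact ⟨(hF l).1, (hF l).2.1⟩
  · rintro i hi l rfl
    exact ⟨(hF l).1, (hF l).2.1, (hF l).2.2 (by simpa using hi)⟩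

lemma ty_walk {E : Bool → Fin n → Fin n → Prop} {z : ℕ → Fin n × Bool}
    (hz : ∀ i, Imp E (z i) (z (i+1))) (i : ℕ) : (z i).2 = ty (z 0).2 i := by
  induction i with
  | zero => simp [ty]
  | succ i ih => rw [(hz i).1, ih]; simp [ty]

lemma bad_struct (T H : Fin m → Bool) (a b c : Fin m → Fin k) (F : Fin m → (Fin k ↪ Fin n))
    (hF : ¬ goodF T H a b c F) :
    ∃ L ∈ range (n+1), ∃ β : Bool, ∃ j e : Fin (L+1), ∃ y : Fin (L+2) → Fin n,
      (j ≠ 0 ∧ y j.castSucc = y 0 ∧ y (Fin.last _) = y e.castSucc) ∧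
      ∃ t : Fin (L+1) → Fin m, Function.Injective t ∧ ∀ l : Fin (L+1),
        stepOk T H a b c F (ty β l) (y l.castSucc) (y l.succ) (t l) := by
  have hs : ∀ β v u, edgeG T H a b c F β v u → edgeG T H a b c F β u v := by
    rintro β v u ⟨i, h1, h2, h3⟩
    exact ⟨i, h1, h2.symm, h3⟩
  obtain ⟨L, j, e, z, hL, hj0, hjL, heL, hzj, hze, hz, hinj⟩ := tadpole hs hF
  have hty := ty_walk hz
  have hex : ∀ l : Fin (L+1), ∃ i, stepOk T H a b c F (ty (z 0).2 l) (z l).1 (z (l+1)).1 i := by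
    intro l
    have := (hz l).2
    rw [hty] at this
    exact this
  choose t ht using hex
  have hlt : ∀ l l' : Fin (L+1), l < l' → t l ≠ t l' := by
    intro l l' hll heq
    have h1 := ht l
    have h2 := ht l'
    rw [← heq] at h2
    have htt : (z l).2 = (z l').2 := by rw [hty l, hty l', ← h1.1, ← h2.1]
    have hm1 := h1.2.1
    have hm2 := h2.2.1
    have hor : (z l).1 = (z l').1 ∨ (z (l+1)).1 = (z l').1 := by
      rcases hm1 with ⟨p, q⟩ | ⟨p, q⟩ <;> rcases hm2 with ⟨p', q'⟩ | ⟨p', q'⟩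
      · left; rw [← p, ← p']
      · right; rw [← q, ← q']
      · right; rw [← p, ← p']
      · left; rw [← q, ← q']
    have hll' : l.1 < l'.1 := hll
    rcases hor with h | h
    · obtain ⟨h0, h0'⟩ := hinj _ _ hll' (by omega) h
      rw [h0, h0', hzj] at htt
      simp [lneg] at htt
    · rcases Nat.lt_or_ge (l.1+1) l'.1 with h' | h'
      · obtain ⟨h0, h0'⟩ := hinj _ _ h' (by omega) h
        omega
      · have : l'.1 = l.1 + 1 := by omega
        rw [this, (hz l).1] at htt
        simp at htt
  refine ⟨L, by simpa [Nat.lt_succ_iff] using hL, (z 0).2, ⟨j, by omega⟩, ⟨e, by omega⟩,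
    fun i => (z i).1, ⟨?_, ?_, ?_⟩, t, ?_, fun l => by simpa using ht l⟩
  · intro h
    have := congrArg Fin.val h
    simp at this
    omega
  · simp [hzj, lneg]
  · simpa using hze
  · intro l l' h
    by_contra hne
    rcases lt_or_gt_of_ne hne with h' | h'
    · exact hlt _ _ h' h
    · exact hlt _ _ h' h.symm

open Classical in
lemma y_count (L : ℕ) (j e : Fin (L+1)) :
    (univ.filter fun y : Fin (L+2) → Fin n =>
      (j ≠ 0 ∧ y j.castSucc = y 0 ∧ y (Fin.last _) = y e.castSucc)).card ≤ n ^ L := by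
  have hc : (univ : Finset ({i : Fin (L+1) // i ≠ j} → Fin n)).card = n ^ L := by
    rw [card_univ, Fintype.card_fun, Fintype.card_subtype_compl]
    simp
  rw [← hc]
  refine card_le_card_of_injOn (fun y i => y i.1.castSucc) (by simp) ?_
  intro y hy y' hy' h
  simp only [coe_filter, mem_univ, true_and, Set.mem_ofPred_eq] at hy hy'
  have h1 : ∀ i : Fin (L+1), y i.castSucc = y' i.castSucc := by
    intro i
    by_cases hi : i = j
    · subst hi
      rw [hy.2.1, hy'.2.1]
      exact congrFun h ⟨0, fun h0 => hy.1 h0.symm⟩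
    · exact congrFun h ⟨i, hi⟩
  funext i
  refine Fin.lastCases ?_ h1 i
  rw [hy.2.2, hy'.2.2, h1]

open Classical in
lemma bad_count (T H : Fin m → Bool) (a b c : Fin m → Fin k) (hab : ∀ i, a i ≠ b i)
    (hac : ∀ i, a i ≠ c i) (hbc : ∀ i, b i ≠ c i) (hn : 3 ≤ n) :
    ((univ.filter (fun F : Fin m → (Fin k ↪ Fin n) => ¬ goodF T H a b c F)).card : ℝ) ≤
    (Fintype.card (Fin k ↪ Fin n) : ℝ) ^ m * ∑ L ∈ range (n+1), ∑ β : Bool, ((L:ℝ)+1)^2 * (n:ℝ)^L *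
      ∏ l ∈ range (L+1), ∑ i, gw T H n (ty β l) i := by
  set ce : ℝ := (Fintype.card (Fin k ↪ Fin n) : ℝ) with hce
  let ev : (L : ℕ) → Bool → (Fin (L+2) → Fin n) → (Fin (L+1) → Fin m) →
    Finset (Fin m → (Fin k ↪ Fin n)) := fun L β y t => univ.filter (fun F => ∀ l : Fin (L+1),
      stepOk T H a b c F (ty β l) (y l.castSucc) (y l.succ) (t l))
  let Y : (L : ℕ) → (j e : Fin (L+1)) → Finset (Fin (L+2) → Fin n) := fun L j e =>
    univ.filter fun y => (j ≠ 0 ∧ y j.castSucc = y 0 ∧ y (Fin.last _) = y e.castSucc)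
  have hsub : (univ.filter (fun F : Fin m → (Fin k ↪ Fin n) => ¬ goodF T H a b c F)) ⊆
      (range (n+1)).biUnion fun L => univ.biUnion fun β : Bool => univ.biUnion fun j : Fin (L+1) =>
      univ.biUnion fun e : Fin (L+1) => (Y L j e).biUnion fun y =>
      (univ.filter fun t : Fin (L+1) → Fin m => Function.Injective t).biUnion fun t => ev L β y t := by
    intro F hF
    simp only [mem_filter, mem_univ, true_and] at hF
    obtain ⟨L, hL, β, j, e, y, hy, t, ht, h⟩ := bad_struct T H a b c F hF
    simp only [mem_biUnion, mem_univ, true_and, mem_filter, Y, ev]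
    exact ⟨L, hL, β, j, e, y, hy, t, ht, h⟩
  have hcard := (card_le_card hsub).trans <| card_biUnion_le.trans <| sum_le_sum fun L _ =>
    card_biUnion_le.trans <| sum_le_sum fun β _ => card_biUnion_le.trans <| sum_le_sum fun j _ =>
    card_biUnion_le.trans <| sum_le_sum fun e _ => card_biUnion_le.trans <| sum_le_sum fun y _ =>
    card_biUnion_le (s := (univ.filter fun t : Fin (L+1) → Fin m => Function.Injective t))
      (t := fun t => ev L β y t)
  have hcard' := (Nat.cast_le (α := ℝ)).mpr hcard
  push_cast at hcard'
  refine hcard'.trans ?_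
  rw [mul_sum]
  refine sum_le_sum fun L _ => ?_
  rw [mul_sum]
  refine sum_le_sum fun β _ => ?_
  have hin : ∀ y, ∑ t with Function.Injective t, ((ev L β y t).card : ℝ) ≤
      ce ^ m * ∏ l ∈ range (L+1), ∑ i, gw T H n (ty β l) i := by
    intro y
    calc _ ≤ ∑ t : Fin (L+1) → Fin m with Function.Injective t,
          ce ^ m * ∏ l : Fin (L+1), gw T H n (ty β l) (t l) :=
          sum_le_sum fun t ht => ev_bound T H a b c hab hac hbc hn L β y t (mem_filter.mp ht).2
      _ ≤ ∑ t : Fin (L+1) → Fin m, ce ^ m * ∏ l : Fin (L+1), gw T H n (ty β l) (t l) :=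
          sum_le_sum_of_subset_of_nonneg (filter_subset _ _) fun t _ _ =>
            mul_nonneg (by positivity) (prod_nonneg fun l _ => gw_nonneg T H hn _ _)
      _ = _ := by
          rw [← mul_sum, prod_range (fun l => ∑ i, gw T H n (ty β l) i), Fintype.prod_sum]
  have hnn : 0 ≤ ce ^ m * ∏ l ∈ range (L+1), ∑ i, gw T H n (ty β l) i :=
    mul_nonneg (by positivity) (prod_nonneg fun l _ => sum_nonneg fun i _ => gw_nonneg T H hn _ _)
  calc _ ≤ ∑ j : Fin (L+1), ∑ e : Fin (L+1), ∑ y ∈ Y L j e,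
        ce ^ m * ∏ l ∈ range (L+1), ∑ i, gw T H n (ty β l) i :=
        sum_le_sum fun j _ => sum_le_sum fun e _ => sum_le_sum fun y _ => hin y
    _ ≤ ∑ j : Fin (L+1), ∑ e : Fin (L+1), (n:ℝ)^L *
        (ce ^ m * ∏ l ∈ range (L+1), ∑ i, gw T H n (ty β l) i) := by
        refine sum_le_sum fun j _ => sum_le_sum fun e _ => ?_
        rw [sum_const, nsmul_eq_mul]
        refine mul_le_mul_of_nonneg_right ?_ hnn
        exact_mod_cast y_count L j e
    _ = _ := by
        simp only [sum_const, card_univ, Fintype.card_fin, nsmul_eq_mul]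
        push_cast
        ring

end Main

section Analytic

lemma prod_alt (q : Bool → ℝ) (hq : ∀ b, 0 ≤ q b) {r K : ℝ} (hr : 0 < r) (hK : 1 ≤ K)
    (h2 : q true * q false ≤ r ^ 2) (h1 : ∀ b, q b ≤ K * r) (β : Bool) (L : ℕ) :
    ∏ l ∈ range L, q (ty β l) ≤ K * r ^ L := by
  induction L using Nat.twoStepInduction with
  | zero => simpa using hK
  | one => simpa using h1 _
  | more L ih _ =>
    rw [prod_range_succ, prod_range_succ, mul_assoc]
    have : q (ty β L) * q (ty β (L+1)) = q true * q false := by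
      have h : ty β (L+1) = !(ty β L) := by simp [ty]
      rw [h]
      cases ty β L
      · simp [mul_comm]
      · simp
    rw [this]
    calc _ ≤ (K * r ^ L) * r ^ 2 := mul_le_mul ih h2 (mul_nonneg (hq _) (hq _)) (by positivity)
      _ = _ := by ring

open Classical in
lemma bad_prob {δ θ : ℝ} (hδ : 0 < δ) (hθ : 0 < θ) (hδθ : δ * θ < 1) :
    ∃ K : ℝ, ∀ (m n k : ℕ) (T H : Fin m → Bool) (a b c : Fin m → Fin k), (∀ i, a i ≠ b i) →
    (∀ i, a i ≠ c i) → (∀ i, b i ≠ c i) → 3 ≤ n →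
    n * ∑ i, gw T H n true i ≤ δ → n * ∑ i, gw T H n false i ≤ θ →
    ((univ.filter (fun F : Fin m → (Fin k ↪ Fin n) => ¬ goodF T H a b c F)).card : ℝ) ≤
    (Fintype.card (Fin k ↪ Fin n) : ℝ) ^ m * (K / n) := by
  set r := √(δ * θ) with hr
  have hr2 : r ^ 2 = δ * θ := Real.sq_sqrt (by positivity)
  have hr0 : 0 < r := Real.sqrt_pos.mpr (by positivity)
  have hr1 : r < 1 := by
    rw [hr, Real.sqrt_lt' one_pos]; simpa using hδθ
  have hsum : Summable (fun L : ℕ => ((L:ℝ)+1)^2 * r ^ (L+1)) := by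
    have := summable_pow_mul_geometric_of_norm_lt_one 2 (r := r)
      (by rwa [Real.norm_of_nonneg hr0.le])
    have := (summable_nat_add_iff 1).mpr this
    simpa using this
  set K0 : ℝ := 1 + δ / r + θ / r with hK0
  have hd : 0 < δ / r := by positivity
  have ht : 0 < θ / r := by positivity
  have hK01 : 1 ≤ K0 := by linarith
  refine ⟨2 * K0 * ∑' L : ℕ, ((L:ℝ)+1)^2 * r ^ (L+1), ?_⟩
  intro m n k T H a b c hab hac hbc hn hN hP
  have hn0 : (0:ℝ) < n := by exact_mod_cast (by omega : 0 < n)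
  refine (bad_count T H a b c hab hac hbc hn).trans ?_
  refine mul_le_mul_of_nonneg_left ?_ (by positivity)
  let q : Bool → ℝ := fun b => n * ∑ i, gw T H n b i
  have hq : ∀ b, 0 ≤ q b := fun b => mul_nonneg hn0.le (sum_nonneg fun i _ => gw_nonneg T H hn _ _)
  have hqp : ∀ β L, ∏ l ∈ range L, q (ty β l) ≤ K0 * r ^ L := by
    intro β L
    refine prod_alt q hq hr0 hK01 ?_ ?_ β L
    · rw [hr2]; exact mul_le_mul hN hP (hq _) hδ.le
    · have e1 : δ / r * r = δ := div_mul_cancel₀ _ hr0.ne'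
      have e2 : θ / r * r = θ := div_mul_cancel₀ _ hr0.ne'
      have e3 : K0 * r = r + δ + θ := by rw [hK0, add_mul, add_mul, e1, e2]; ring
      intro b
      rw [e3]
      cases b
      · exact hP.trans (by linarith)
      · exact hN.trans (by linarith)
  have hterm : ∀ (L : ℕ) (β : Bool), ((L:ℝ)+1)^2 * (n:ℝ)^L * ∏ l ∈ range (L+1), ∑ i, gw T H n (ty β l) i ≤
      K0 / n * (((L:ℝ)+1)^2 * r ^ (L+1)) := by
    intro L β
    have h := hqp β (L+1)
    simp only [q, prod_mul_distrib, prod_const, card_range] at h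
    rw [div_mul_eq_mul_div, le_div_iff₀ hn0]
    calc _ = ((L:ℝ)+1)^2 * ((n:ℝ)^(L+1) * ∏ l ∈ range (L+1), ∑ i, gw T H n (ty β l) i) := by ring
      _ ≤ ((L:ℝ)+1)^2 * (K0 * r ^ (L+1)) := mul_le_mul_of_nonneg_left h (by positivity)
      _ = _ := by ring
  calc _ ≤ ∑ L ∈ range (n+1), ∑ β : Bool, K0 / n * (((L:ℝ)+1)^2 * r ^ (L+1)) :=
        sum_le_sum fun L _ => sum_le_sum fun β _ => hterm L β
    _ = 2 * K0 / n * ∑ L ∈ range (n+1), (((L:ℝ)+1)^2 * r ^ (L+1)) := by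
        rw [mul_sum]; refine sum_congr rfl fun L _ => ?_
        simp; ring
    _ ≤ 2 * K0 / n * ∑' L : ℕ, ((L:ℝ)+1)^2 * r ^ (L+1) := by
        refine mul_le_mul_of_nonneg_left ?_ (by positivity)
        exact hsum.sum_le_tsum _ fun L _ => by positivity
    _ = _ := by ring

lemma gw_sum_true {m n : ℕ} (T H : Fin m → Bool) (hn : 3 ≤ n) {N : ℝ}
    (hN : ((univ.filter (fun i => T i = true)).card : ℝ) ≤ N) :
    n * ∑ i, gw T H n true i ≤ 2 * N / (n - 1) := by
  have h3 : (3 : ℝ) ≤ n := by exact_mod_cast hn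
  have h1 : (0:ℝ) < n - 1 := by linarith
  have : ∑ i, gw T H n true i = (univ.filter (fun i => T i = true)).card * (2 / (n * (n-1))) := by
    rw [← nsmul_eq_mul, ← sum_const, sum_filter]
    refine sum_congr rfl fun i _ => ?_
    unfold gw
    by_cases h : T i = true <;> simp [h]
  rw [this]
  have h0 : (0:ℝ) < n := by linarith
  calc _ = 2 * ((univ.filter (fun i => T i = true)).card : ℝ) / (n - 1) := by field_simp
    _ ≤ _ := by gcongr

lemma gw_sum_false {m n : ℕ} (T H : Fin m → Bool) (hn : 3 ≤ n) {N M : ℝ}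
    (hN : ((univ.filter (fun i => T i = true)).card : ℝ) ≤ N)
    (hM : ((univ.filter (fun i => T i = false ∧ H i = false)).card : ℝ) ≤ M) :
    n * ∑ i, gw T H n false i ≤ 2 * M / (n - 1) + m * (4 * N) / ((n - 1) * (n - 2)) := by
  have h3 : (3 : ℝ) ≤ n := by exact_mod_cast hn
  have h1 : (0:ℝ) < n - 1 := by linarith
  have h2 : (0:ℝ) < n - 2 := by linarith
  have h0 : (0:ℝ) < n := by linarith
  have hN0 : 0 ≤ N := le_trans (by positivity) hN
  have : ∑ i, gw T H n false i ≤ ∑ i, ((if T i = false ∧ H i = false then 2 / ((n:ℝ) * (n-1)) else 0)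
      + 4 * N / (n * (n - 1) * (n - 2))) := by
    refine sum_le_sum fun i _ => ?_
    have hx : (0:ℝ) ≤ 4 * N / (n * (n - 1) * (n - 2)) := by positivity
    have hy : (0:ℝ) ≤ 2 / ((n:ℝ) * (n-1)) := by positivity
    unfold gw
    by_cases hT : T i = false
    · by_cases hH : H i = true
      · simp only [hT, hH]
        simp only [and_self, if_true, Bool.true_eq_false, and_false, if_false, zero_add]
        push_cast
        rw [← mul_assoc]
        norm_num
        gcongr
      · have hH' : H i = false := by simpa using hH
        simp only [hT, hH']
        simp
        simpa using hx
    · simp [hT, hx]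
  calc _ ≤ (n:ℝ) * _ := mul_le_mul_of_nonneg_left this h0.le
    _ = 2 * ((univ.filter (fun i => T i = false ∧ H i = false)).card : ℝ) / (n - 1) +
        m * (4 * N) / ((n - 1) * (n - 2)) := by
        rw [sum_add_distrib, ← sum_filter, sum_const, sum_const, nsmul_eq_mul, nsmul_eq_mul]
        simp only [card_univ, Fintype.card_fin]
        field_simp
    _ ≤ _ := by gcongr

lemma ratio_tendsto (c d : ℝ) : Tendsto (fun n : ℕ => (c * n + 1) / ((n:ℝ) - d)) atTop (nhds c) := by
  have h1 : Tendsto (fun n : ℕ => (n:ℝ) - d) atTop atTop :=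
    tendsto_atTop_add_const_right _ (-d) tendsto_natCast_atTop_atTop
  have h2 : Tendsto (fun n : ℕ => c + (c * d + 1) / ((n:ℝ) - d)) atTop (nhds (c + 0)) :=
    tendsto_const_nhds.add (h1.const_div_atTop _)
  rw [add_zero] at h2
  refine h2.congr' ?_
  filter_upwards [h1.eventually_gt_atTop 0] with n hn
  field_simp
  ring

open Classical in
/-- conditional bound, given the signs -/
lemma cond_bound {c b1 b2 : ℝ} (hc : 0 < c) (hb1 : 0 < b1) (hb2 : 0 < b2)
    (h : 4 * c ^ 2 * b1 * (b2 + 2 * c * b1) < 1) :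
    ∃ K : ℝ, ∀ᶠ n : ℕ in atTop, ∀ (m k : ℕ) (T H : Fin m → Bool) (a b e : Fin m → Fin k),
    (∀ i, a i ≠ b i) → (∀ i, a i ≠ e i) → (∀ i, b i ≠ e i) → (m : ℝ) ≤ c * n + 1 →
    ((univ.filter (fun i => T i = true)).card : ℝ) ≤ b1 * m →
    ((univ.filter (fun i => T i = false ∧ H i = false)).card : ℝ) ≤ b2 * m →
    ((univ.filter (fun F : Fin m → (Fin k ↪ Fin n) => ¬ goodF T H a b e F)).card : ℝ) ≤
    (Fintype.card (Fin k ↪ Fin n) : ℝ) ^ m * (K / n) := by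
  set δ0 := 2 * b1 * c with hδ0
  set θ0 := 2 * b2 * c + 4 * b1 * (c * c) with hθ0
  have hp : δ0 * θ0 < 1 := by rw [hδ0, hθ0]; nlinarith
  have hδ0p : 0 < δ0 := by positivity
  have hθ0p : 0 < θ0 := by positivity
  obtain ⟨ε, hε, hlt⟩ : ∃ ε > 0, (δ0 + ε) * (θ0 + ε) < 1 := by
    have hcont : Tendsto (fun ε : ℝ => (δ0 + ε) * (θ0 + ε)) (nhdsWithin 0 (Set.Ioi 0))
        (nhds ((δ0 + 0) * (θ0 + 0))) := by
      apply tendsto_nhdsWithin_of_tendsto_nhds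
      exact Continuous.tendsto (by fun_prop) 0
    rw [add_zero, add_zero] at hcont
    obtain ⟨ε, h1, h2⟩ := ((hcont.eventually (gt_mem_nhds hp)).and self_mem_nhdsWithin).exists
    exact ⟨ε, h2, h1⟩
  obtain ⟨K, hK⟩ := bad_prob (δ := δ0 + ε) (θ := θ0 + ε) (by positivity) (by positivity) hlt
  refine ⟨K, ?_⟩
  have t1 := (ratio_tendsto c 1)
  have t2 := (ratio_tendsto c 2)
  have t3 : Tendsto (fun n : ℕ => 2 * b1 * ((c * n + 1) / ((n:ℝ) - 1))) atTop (nhds δ0) :=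
    t1.const_mul _
  have t4 : Tendsto (fun n : ℕ => 2 * b2 * ((c * n + 1) / ((n:ℝ) - 1)) + 4 * b1 *
      (((c * n + 1) / ((n:ℝ) - 1)) * ((c * n + 1) / ((n:ℝ) - 2)))) atTop (nhds θ0) :=
    (t1.const_mul _).add ((t1.mul t2).const_mul _)
  filter_upwards [t3.eventually (gt_mem_nhds (show δ0 < δ0 + ε by linarith)),
    t4.eventually (gt_mem_nhds (show θ0 < θ0 + ε by linarith)), eventually_ge_atTop 3]
    with n hn1 hn2 hn m k T H a b e hab hae hbe hm hN hM
  have h3 : (3 : ℝ) ≤ n := by exact_mod_cast hn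
  have h1 : (0:ℝ) < n - 1 := by linarith
  have h2 : (0:ℝ) < n - 2 := by linarith
  have hcn : 0 ≤ c * n + 1 := by positivity
  refine hK m n k T H a b e hab hae hbe hn ?_ ?_
  · refine (gw_sum_true T H hn hN).trans (le_trans ?_ hn1.le)
    calc 2 * (b1 * m) / ((n:ℝ) - 1) ≤ 2 * (b1 * (c * n + 1)) / ((n:ℝ) - 1) := by gcongr
      _ = _ := by ring
  · refine (gw_sum_false T H hn hN hM).trans (le_trans ?_ hn2.le)
    calc _ ≤ 2 * (b2 * (c * n + 1)) / ((n:ℝ) - 1) +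
          (c * n + 1) * (4 * (b1 * (c * n + 1))) / (((n:ℝ) - 1) * (n - 2)) := by gcongr
      _ = _ := by field_simp

end Analytic

section Conc

open Classical in
lemma conc {α : Type*} [Fintype α] [Nonempty α] (S : Finset α) (b : ℝ)
    (hb : (S.card : ℝ) < b * Fintype.card α) :
    ∃ q : ℝ, 0 ≤ q ∧ q < 1 ∧ ∀ m : ℕ,
      ((univ.filter (fun A : Fin m → α => b * m < ((univ.filter fun i => A i ∈ S).card : ℝ))).card : ℝ)
        ≤ (Fintype.card α : ℝ) ^ m * q ^ m := by
  have hα : (0:ℝ) < Fintype.card α := by exact_mod_cast Fintype.card_pos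
  set p : ℝ := S.card / Fintype.card α with hp
  have hpb : p < b := by rwa [hp, div_lt_iff₀ hα]
  have hp0 : 0 ≤ p := by positivity
  have hp1 : p ≤ 1 := by
    rw [hp, div_le_one hα]; exact_mod_cast card_le_univ S
  set s : ℝ := min 1 ((b - p) / 2) with hs
  have hs0 : 0 < s := lt_min one_pos (by linarith)
  have hs1 : s ≤ 1 := min_le_left _ _
  have hs2 : s ≤ (b - p) / 2 := min_le_right _ _
  have hexp : Real.exp s - 1 ≤ s + s ^ 2 := by
    have := Real.abs_exp_sub_one_sub_id_le (x := s) (by rwa [abs_of_pos hs0])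
    have := le_of_abs_le this
    linarith
  have hneg : (Real.exp s - 1) * p - s * b < 0 := by nlinarith
  refine ⟨Real.exp ((Real.exp s - 1) * p - s * b), (Real.exp_pos _).le, by simpa using hneg, ?_⟩
  intro m
  set Ev := (univ.filter (fun A : Fin m → α => b * m < ((univ.filter fun i => A i ∈ S).card : ℝ)))
  have hsum : ∑ A : Fin m → α, ∏ i, (if A i ∈ S then Real.exp s else 1) =
      (Fintype.card α * (1 + (Real.exp s - 1) * p)) ^ m := by
    rw [← Fintype.prod_sum (fun (_ : Fin m) (x : α) => if x ∈ S then Real.exp s else 1)]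
    rw [prod_const, card_univ, Fintype.card_fin]
    congr 1
    have : ∀ x : α, (if x ∈ S then Real.exp s else 1) = 1 + (if x ∈ S then Real.exp s - 1 else 0) := by
      intro x; split_ifs <;> ring
    simp only [this, sum_add_distrib]
    rw [← sum_filter, sum_const, sum_const]
    simp
    rw [hp]; field_simp
  have h1 : (Ev.card : ℝ) * Real.exp (s * (b * m)) ≤
      ∑ A : Fin m → α, ∏ i, (if A i ∈ S then Real.exp s else 1) := by
    rw [← nsmul_eq_mul, ← sum_const]
    refine le_trans (sum_le_sum fun A hA => ?_) (sum_le_sum_of_subset_of_nonneg (subset_univ Ev)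
      fun A _ _ => prod_nonneg fun i _ => by split_ifs <;> positivity)
    rw [← prod_filter, prod_const, ← Real.exp_nat_mul]
    have := (mem_filter.mp hA).2
    refine Real.exp_le_exp.mpr ?_
    nlinarith
  rw [hsum] at h1
  have h2 : 1 + (Real.exp s - 1) * p ≤ Real.exp ((Real.exp s - 1) * p) := by
    have := Real.add_one_le_exp ((Real.exp s - 1) * p); linarith
  have h0 : 0 ≤ 1 + (Real.exp s - 1) * p := by
    have : 0 ≤ Real.exp s - 1 := by have := Real.add_one_le_exp s; linarith
    positivity
  have h3 : (Ev.card : ℝ) * Real.exp (s * (b * m)) ≤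
      (Fintype.card α : ℝ) ^ m * (Real.exp ((Real.exp s - 1) * p)) ^ m := by
    refine h1.trans ?_
    rw [mul_pow]; gcongr
  have h4 : (Real.exp ((Real.exp s - 1) * p - s * b)) ^ m * Real.exp (s * (b * m)) =
      (Real.exp ((Real.exp s - 1) * p)) ^ m := by
    rw [← Real.exp_nat_mul, ← Real.exp_nat_mul, ← Real.exp_add]; congr 1; ring
  rw [← h4] at h3
  refine le_of_mul_le_mul_right (a := Real.exp (s * (b * m))) ?_ (Real.exp_pos _)
  rw [mul_assoc ((Fintype.card α : ℝ) ^ m)]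
  exact h3

end Conc

section UP

lemma unifProb_equiv {α β : Type*} [Fintype α] [Fintype β] (e : α ≃ β) (P : β → Prop) :
    unifProb (fun a => P (e a)) = unifProb P := by
  unfold unifProb
  rw [Fintype.card_congr e, Nat.card_congr (e.subtypeEquiv (p := fun a => P (e a)) (q := P)
    (fun a => Iff.rfl))]

lemma unifProb_nonneg {α : Type*} [Fintype α] (P : α → Prop) : 0 ≤ unifProb P := by
  unfold unifProb; positivity

lemma unifProb_eq {α : Type*} [Fintype α] (P : α → Prop) [DecidablePred P] :
    unifProb P = ((univ.filter P).card : ℝ) / Fintype.card α := by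
  unfold unifProb
  rw [Nat.card_eq_fintype_card, Fintype.card_subtype]

lemma unifProb_mono {α : Type*} [Fintype α] {P Q : α → Prop} (h : ∀ a, P a → Q a) :
    unifProb P ≤ unifProb Q := by
  classical
  rw [unifProb_eq, unifProb_eq]
  gcongr with a
  exact h a

lemma unifProb_or {α : Type*} [Fintype α] (P Q : α → Prop) :
    unifProb (fun a => P a ∨ Q a) ≤ unifProb P + unifProb Q := by
  classical
  rw [unifProb_eq, unifProb_eq, unifProb_eq, ← add_div]
  gcongr
  rw [filter_or]
  exact_mod_cast card_union_le _ _

lemma unifProb_compl {α : Type*} [Fintype α] [Nonempty α] (P : α → Prop) :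
    unifProb P = 1 - unifProb (fun a => ¬ P a) := by
  classical
  have hα : (0:ℝ) < Fintype.card α := by exact_mod_cast Fintype.card_pos
  rw [unifProb_eq, unifProb_eq, eq_sub_iff_add_eq, ← add_div, div_eq_one_iff_eq hα.ne']
  rw [← card_univ, ← card_filter_add_card_filter_not (s := univ) P]
  push_cast; rfl

lemma unifProb_fst {α β : Type*} [Fintype α] [Fintype β] [Nonempty β] (P : α → Prop) :
    unifProb (fun x : α × β => P x.1) = unifProb P := by
  classical
  have hβ : (0:ℝ) < Fintype.card β := by exact_mod_cast Fintype.card_pos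
  rw [unifProb_eq, unifProb_eq]
  have : (univ.filter (fun x : α × β => P x.1)) = (univ.filter P) ×ˢ (univ : Finset β) := by
    ext x; simp
  rw [this, card_product, Fintype.card_prod, card_univ]
  push_cast
  rw [mul_div_mul_right _ _ hβ.ne']

lemma unifProb_split {α β : Type*} [Fintype α] [Fintype β] (P : α × β → Prop)
    (Q : α → Prop) {ε : ℝ} (hε : 0 ≤ ε) (h : ∀ a, Q a → unifProb (fun b => P (a, b)) ≤ ε) :
    unifProb P ≤ unifProb (fun a => ¬ Q a) + ε := by
  classical
  rcases isEmpty_or_nonempty α with hα | hα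
  · have : unifProb P = 0 := by unfold unifProb; simp
    rw [this]; have := unifProb_nonneg (fun a => ¬ Q a); linarith
  rcases isEmpty_or_nonempty β with hβ | hβ
  · have : unifProb P = 0 := by unfold unifProb; simp
    rw [this]; have := unifProb_nonneg (fun a => ¬ Q a); linarith
  have h1 : unifProb P ≤ unifProb (fun x : α × β => ¬ Q x.1) +
      unifProb (fun x : α × β => Q x.1 ∧ P x) := by
    refine le_trans (unifProb_mono ?_) (unifProb_or _ _)
    intro a ha; by_cases hq : Q a.1
    · exact Or.inr ⟨hq, ha⟩
    · exact Or.inl hq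
  rw [unifProb_fst (fun a => ¬ Q a)] at h1
  refine h1.trans ?_
  gcongr
  have hα' : (0:ℝ) < Fintype.card α := by exact_mod_cast Fintype.card_pos
  have hβ' : (0:ℝ) < Fintype.card β := by exact_mod_cast Fintype.card_pos
  rw [unifProb_eq, Fintype.card_prod]
  push_cast
  rw [div_le_iff₀ (by positivity)]
  have hc : (univ.filter (fun x : α × β => Q x.1 ∧ P x)).card =
      ∑ a : α, (univ.filter (fun b : β => Q a ∧ P (a, b))).card := by
    simp only [card_filter]
    rw [Fintype.sum_prod_type]
  rw [hc]
  push_cast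
  calc _ ≤ ∑ a : α, ε * (Fintype.card β : ℝ) := by
        refine sum_le_sum fun a _ => ?_
        by_cases hq : Q a
        · have := h a hq
          rw [unifProb_eq, div_le_iff₀ hβ'] at this
          simpa [hq] using this
        · simp [hq]; positivity
    _ = _ := by simp; ring

lemma unifProb_pick {E : Type*} [Fintype E] [Nonempty E] {m : ℕ} (idx : Fin m → Fin 5)
    (P : (Fin m → E) → Prop) :
    unifProb (fun g : Fin m → Fin 5 → E => P (fun i => g i (idx i))) = unifProb P := by
  classical
  let e1 : (Fin m → Fin 5 → E) ≃ (Fin m → E × ({j : Fin 5 // j ≠ 0} → E)) :=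
    Equiv.piCongrRight fun i =>
      (Equiv.arrowCongr (Equiv.swap (idx i) 0) (Equiv.refl E)).trans (Equiv.funSplitAt 0 E)
  let e2 : (Fin m → E × ({j : Fin 5 // j ≠ 0} → E)) ≃
    (Fin m → E) × (Fin m → ({j : Fin 5 // j ≠ 0} → E)) := Equiv.arrowProdEquivProdArrow _ _ _
  rw [← unifProb_fst (β := (Fin m → ({j : Fin 5 // j ≠ 0} → E))) P,
    ← unifProb_equiv (e1.trans e2)]
  congr 1
  funext g
  congr 1
  funext i
  simp [e1, e2, Equiv.arrowProdEquivProdArrow, Equiv.arrowCongr]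

end UP

section CL
variable {n k : ℕ}

/-- the clause of an ordered clause -/
def mkC (x : (Fin k → Bool) × (Fin k ↪ Fin n)) : Clause n k :=
  ⟨univ.image (fun i => (x.2 i, x.1 i)), by
    rw [card_image_of_injective]
    · simp
    · intro i j h; exact x.2.injective (Prod.mk.inj h).1, by
    rw [image_image, card_image_of_injective]
    · simp
    · intro i j h; exact x.2.injective h⟩

lemma mkC_posCount (x : (Fin k → Bool) × (Fin k ↪ Fin n)) :
    (mkC x).posCount = (univ.filter (fun i => x.1 i = true)).card := by
  unfold Clause.posCount mkC
  rw [filter_image, card_image_of_injective]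
  intro i j h; exact x.2.injective (Prod.mk.inj h).1

noncomputable def eC (C : Clause n k) : Fin k ≃ C.1 :=
  (finCongr C.2.1.symm).trans C.1.equivFin.symm

noncomputable def ordC (x : Clause n k × Equiv.Perm (Fin k)) :
    (Fin k → Bool) × (Fin k ↪ Fin n) :=
  (fun i => (eC x.1 (x.2 i)).1.2, ⟨fun i => (eC x.1 (x.2 i)).1.1, by
    intro i j h
    have hinj : Set.InjOn Prod.fst (x.1.1 : Set (Lit n)) :=
      card_image_iff.mp (x.1.2.2.trans x.1.2.1.symm)
    have := hinj (eC x.1 (x.2 i)).2 (eC x.1 (x.2 j)).2 h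
    exact x.2.injective ((eC x.1).injective (Subtype.ext this))⟩)

lemma mkC_ordC (x : Clause n k × Equiv.Perm (Fin k)) : mkC (ordC x) = x.1 := by
  apply Subtype.ext
  ext p
  simp only [mkC, ordC, mem_image, mem_univ, true_and]
  constructor
  · rintro ⟨i, rfl⟩; exact (eC x.1 (x.2 i)).2
  · intro hp
    refine ⟨x.2.symm ((eC x.1).symm ⟨p, hp⟩), Prod.ext ?_ ?_⟩
    · change (eC x.1 (x.2 (x.2.symm ((eC x.1).symm ⟨p, hp⟩)))).1.1 = p.1
      simp
    · simp

lemma ordC_bij : Function.Bijective (ordC : Clause n k × Equiv.Perm (Fin k) → _) := by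
  constructor
  · rintro ⟨C, π⟩ ⟨D, ρ⟩ h
    have hC : C = D := by
      have := congrArg mkC h
      rwa [mkC_ordC, mkC_ordC] at this
    subst hC
    congr 1
    ext i
    have h1 := congrFun (congrArg Prod.fst h) i
    have h2 := DFunLike.congr_fun (congrArg Prod.snd h) i
    have : eC C (π i) = eC C (ρ i) := Subtype.ext (Prod.ext h2 h1)
    rw [(eC C).injective this]
  · rintro ⟨s, f⟩
    set C := mkC (s, f) with hC
    have hm : ∀ i, (f i, s i) ∈ C.1 := fun i => mem_image.mpr ⟨i, mem_univ _, rfl⟩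
    have hinj : Function.Injective (fun i => (eC C).symm ⟨(f i, s i), hm i⟩) := by
      intro i j h
      have := (eC C).symm.injective h
      exact f.injective (Prod.mk.inj (Subtype.mk.inj this)).1
    refine ⟨(C, Equiv.ofBijective _ (Finite.injective_iff_bijective.mp hinj)), ?_⟩
    refine Prod.ext ?_ ?_
    · funext i; simp [ordC]
    · ext i; simp [ordC]

noncomputable def ordE : Clause n k × Equiv.Perm (Fin k) ≃ (Fin k → Bool) × (Fin k ↪ Fin n) :=
  Equiv.ofBijective ordC ordC_bij

lemma unifProb_ord {m : ℕ} (P : (Fin m → Fin 5 → Clause n k) → Prop) :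
    unifProb P = unifProb (fun y : (Fin m → Fin 5 → Fin k → Bool) × (Fin m → Fin 5 → (Fin k ↪ Fin n)) =>
      P (fun i j => mkC (y.1 i j, y.2 i j))) := by
  let e0 : (Fin m → Fin 5 → Clause n k) × (Fin m → Fin 5 → Equiv.Perm (Fin k)) ≃
      (Fin m → Fin 5 → Clause n k × Equiv.Perm (Fin k)) :=
    (Equiv.arrowProdEquivProdArrow _ _ _).symm.trans
      (Equiv.piCongrRight fun i => (Equiv.arrowProdEquivProdArrow _ _ _).symm)
  let e1 : (Fin m → Fin 5 → Clause n k × Equiv.Perm (Fin k)) ≃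
      (Fin m → Fin 5 → (Fin k → Bool) × (Fin k ↪ Fin n)) :=
    Equiv.piCongrRight fun i => Equiv.piCongrRight fun j => ordE
  let e2 : (Fin m → Fin 5 → (Fin k → Bool) × (Fin k ↪ Fin n)) ≃
      (Fin m → Fin 5 → Fin k → Bool) × (Fin m → Fin 5 → (Fin k ↪ Fin n)) :=
    (Equiv.piCongrRight fun i => Equiv.arrowProdEquivProdArrow _ _ _).trans
      (Equiv.arrowProdEquivProdArrow _ _ _)
  rw [← unifProb_fst (β := (Fin m → Fin 5 → Equiv.Perm (Fin k))) P,
    ← unifProb_equiv (e0.trans (e1.trans e2))]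
  congr 1
  funext x
  congr 1
  funext i j
  exact (mkC_ordC (x.1 i j, x.2 i j)).symm

end CL

section Sel
variable {n k : ℕ}

def pc (s : Fin k → Bool) : ℕ := (univ.filter (fun i => s i = true)).card

def sidx (σ : Fin 5 → Fin k → Bool) : Fin 5 :=
  if 2 ≤ pc (σ 0) then 0 else if 2 ≤ pc (σ 1) then 1 else if 2 ≤ pc (σ 2) then 2 else
  if 2 ≤ pc (σ 3) then 3 else 4

lemma select_mk (h : 0 < 5) (σ : Fin 5 → Fin k → Bool) (g : Fin 5 → (Fin k ↪ Fin n)) :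
    select h (fun j => mkC (σ j, g j)) = mkC (σ (sidx σ), g (sidx σ)) := by
  have hp : ∀ j, (mkC (σ j, g j)).posCount = pc (σ j) := fun j => mkC_posCount _
  have hl : List.finRange 5 = [0, 1, 2, 3, 4] := by decide
  unfold select sidx
  simp only [hp, hl]
  by_cases h0 : 2 ≤ pc (σ 0)
  · simp [h0]
  by_cases h1 : 2 ≤ pc (σ 1)
  · simp [h0, h1]
  by_cases h2 : 2 ≤ pc (σ 2)
  · simp [h0, h1, h2]
  by_cases h3 : 2 ≤ pc (σ 3)
  · simp [h0, h1, h2, h3]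
  · simp [h0, h1, h2, h3]

lemma sidx_le_one {σ : Fin 5 → Fin k → Bool} (h : pc (σ (sidx σ)) ≤ 1) (j : Fin 5) :
    pc (σ j) ≤ 1 := by
  unfold sidx at h
  split_ifs at h <;> first | omega | (fin_cases j <;> simp <;> omega)

lemma sidx_two {σ : Fin 5 → Fin k → Bool} (h : pc (σ (sidx σ)) = 2) :
    pc (σ 0) = 2 ∨ (pc (σ 0) ≤ 1 ∧ pc (σ 1) ≤ 2) := by
  unfold sidx at h
  split_ifs at h <;> omega

lemma choice3 (hk : 4 ≤ k) (v : Fin k → Bool) : ∃ a b c : Fin k, a ≠ b ∧ a ≠ c ∧ b ≠ c ∧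
    (pc v ≤ 1 → v a = false ∧ v b = false) ∧ (2 ≤ pc v → v a = true ∧ v b = true) ∧
    (3 ≤ pc v → v c = true) := by
  have htot : pc v + (univ.filter (fun i => ¬ v i = true)).card = k := by
    have := card_filter_add_card_filter_not (s := univ) (fun i => v i = true)
    rw [card_univ, Fintype.card_fin] at this
    exact this
  rcases Nat.lt_or_ge (pc v) 2 with h | h
  · obtain ⟨a, b, c, ha, hb, hc, hab, hac, hbc⟩ :=
      two_lt_card_iff.mp (show 2 < (univ.filter (fun i => ¬ v i = true)).card by omega)
    refine ⟨a, b, c, hab, hac, hbc, fun _ => ?_, fun h => by omega, fun h => by omega⟩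
    simpa using And.intro (mem_filter.mp ha).2 (mem_filter.mp hb).2
  rcases Nat.lt_or_ge (pc v) 3 with h' | h'
  · obtain ⟨a, b, ha, hb, hab⟩ :=
      one_lt_card_iff.mp (show 1 < (univ.filter (fun i => v i = true)).card from h)
    obtain ⟨c, hc⟩ : (({a, b} : Finset (Fin k))ᶜ).Nonempty := by
      rw [← card_pos, card_compl, Fintype.card_fin]
      have := card_le_two (a := a) (b := b)
      omega
    simp at hc
    refine ⟨a, b, c, hab, fun h => hc.1 h.symm, fun h => hc.2 h.symm, fun _ => by omega,
      fun _ => ⟨(mem_filter.mp ha).2, (mem_filter.mp hb).2⟩, fun h => by omega⟩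
  · obtain ⟨a, b, c, ha, hb, hc, hab, hac, hbc⟩ :=
      two_lt_card_iff.mp (show 2 < (univ.filter (fun i => v i = true)).card from h')
    exact ⟨a, b, c, hab, hac, hbc, fun _ => by omega,
      fun _ => ⟨(mem_filter.mp ha).2, (mem_filter.mp hb).2⟩, fun _ => (mem_filter.mp hc).2⟩

lemma good_sat {m : ℕ} (s : Fin m → Fin k → Bool) (a b c : Fin m → Fin k)
    (h1 : ∀ i, pc (s i) ≤ 1 → s i (a i) = false ∧ s i (b i) = false)
    (h2 : ∀ i, 2 ≤ pc (s i) → s i (a i) = true ∧ s i (b i) = true)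
    (h3 : ∀ i, 3 ≤ pc (s i) → s i (c i) = true) (F : Fin m → (Fin k ↪ Fin n))
    (hg : goodF (fun i => decide (pc (s i) ≤ 1)) (fun i => decide (3 ≤ pc (s i))) a b c F) :
    Satisfiable (fun i => mkC (s i, F i)) := by
  obtain ⟨τ, hτ⟩ := hg
  set T : Fin m → Bool := fun i => decide (pc (s i) ≤ 1) with hT
  set H : Fin m → Bool := fun i => decide (3 ≤ pc (s i)) with hH
  set W := wset T a b (fun i => F i.1) with hW
  refine ⟨fun v => if v ∈ W then τ v else true, fun i => ?_⟩
  have key : ∀ j : Fin k, (if F i j ∈ W then τ (F i j) else true) = s i j →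
      Sat (fun v => if v ∈ W then τ v else true) (mkC (s i, F i)) := by
    intro j hj
    exact ⟨(F i j, s i j), mem_image.mpr ⟨j, mem_univ _, rfl⟩, hj⟩
  by_cases hp : pc (s i) ≤ 1
  · have hTi : T i = true := by simp [hT, hp]
    have ha : F i (a i) ∈ W := mem_union_left _ (mem_image.mpr ⟨⟨i, hTi⟩, mem_univ _, rfl⟩)
    have hb : F i (b i) ∈ W := mem_union_right _ (mem_image.mpr ⟨⟨i, hTi⟩, mem_univ _, rfl⟩)
    have := hτ true (F i (a i)) (F i (b i)) ⟨i, hTi, Or.inl ⟨rfl, rfl⟩, by simp [hTi]⟩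
    obtain ⟨sa, sb⟩ := h1 i hp
    rcases not_and_or.mp this with h | h
    · exact key (a i) (by rw [if_pos ha, sa]; simpa using h)
    · exact key (b i) (by rw [if_pos hb, sb]; simpa using h)
  · have hTi : T i = false := by simp [hT]; omega
    obtain ⟨sa, sb⟩ := h2 i (by omega)
    by_cases hc : H i = true ∧ F i (c i) ∉ W
    · exact key (c i) (by rw [if_neg hc.2, h3 i (by simpa [hH] using hc.1)])
    · have := hτ false (F i (a i)) (F i (b i)) ⟨i, hTi, Or.inl ⟨rfl, rfl⟩, fun _ hHi => by
        by_contra hn; exact hc ⟨hHi, hn⟩⟩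
      rcases not_and_or.mp this with h | h
      · exact key (a i) (by rw [sa]; split_ifs <;> simp_all)
      · exact key (b i) (by rw [sb]; split_ifs <;> simp_all)

def S1 (k : ℕ) : Finset (Fin 5 → Fin k → Bool) := univ.filter fun σ => pc (σ (sidx σ)) ≤ 1
def S2 (k : ℕ) : Finset (Fin 5 → Fin k → Bool) := univ.filter fun σ => pc (σ (sidx σ)) = 2

lemma core (hk : 4 ≤ k) {c b1 b2 : ℝ} (hc : 0 < c) (hb1 : 0 < b1) (hb2 : 0 < b2)
    (h : 4 * c ^ 2 * b1 * (b2 + 2 * c * b1) < 1)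
    (hS1 : ((S1 k).card : ℝ) < b1 * Fintype.card (Fin 5 → Fin k → Bool))
    (hS2 : ((S2 k).card : ℝ) < b2 * Fintype.card (Fin 5 → Fin k → Bool)) :
    Tendsto (fun n : ℕ =>
        unifProb (fun A : Fin (⌈c * n⌉₊) → Fin 5 → Clause n k =>
          Satisfiable (fun i => select (by norm_num) (A i))))
      atTop (nhds 1) := by
  classical
  obtain ⟨q1, hq1, hq1', hc1⟩ := conc (S1 k) b1 hS1
  obtain ⟨q2, hq2, hq2', hc2⟩ := conc (S2 k) b2 hS2
  obtain ⟨K, hK⟩ := cond_bound hc hb1 hb2 h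
  have hmt : Tendsto (fun n : ℕ => ⌈c * n⌉₊) atTop atTop :=
    tendsto_nat_ceil_atTop.comp (tendsto_natCast_atTop_atTop.const_mul_atTop hc)
  have hlim : Tendsto (fun n : ℕ => 1 - (q1 ^ ⌈c * n⌉₊ + q2 ^ ⌈c * n⌉₊ + |K| / n)) atTop
      (nhds (1 - (0 + 0 + 0))) := by
    refine tendsto_const_nhds.sub (((?_ : Tendsto _ _ _).add ?_).add ?_)
    · exact (tendsto_pow_atTop_nhds_zero_of_lt_one hq1 hq1').comp hmt
    · exact (tendsto_pow_atTop_nhds_zero_of_lt_one hq2 hq2').comp hmt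
    · exact tendsto_const_div_atTop_nhds_zero_nat _
  simp only [add_zero, sub_zero] at hlim
  refine tendsto_of_tendsto_of_tendsto_of_le_of_le' hlim tendsto_const_nhds ?_ ?_
  swap
  · refine Eventually.of_forall fun n => ?_
    rw [unifProb_eq]
    refine div_le_one_of_le₀ ?_ (by positivity)
    exact_mod_cast card_le_univ _
  filter_upwards [hK, eventually_ge_atTop k] with n hKn hkn
  have : Nonempty (Fin k ↪ Fin n) := ⟨Fin.castLEEmb hkn⟩
  have : Nonempty (Clause n k) := ⟨mkC (fun _ => true, Fin.castLEEmb hkn)⟩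
  rw [unifProb_compl]
  refine sub_le_sub_left ?_ _
  set m := ⌈c * n⌉₊ with hm
  have hmle : (m : ℝ) ≤ c * n + 1 := (Nat.ceil_lt_add_one (by positivity)).le
  rw [unifProb_ord]
  refine (unifProb_split _ (fun A : Fin m → Fin 5 → Fin k → Bool =>
    ((univ.filter fun i => A i ∈ S1 k).card : ℝ) ≤ b1 * m ∧
    ((univ.filter fun i => A i ∈ S2 k).card : ℝ) ≤ b2 * m) (ε := |K| / n) (by positivity) ?_).trans ?_
  · rintro A ⟨hA1, hA2⟩
    simp only [select_mk]
    rw [unifProb_pick (fun i => sidx (A i)) (fun F : Fin m → (Fin k ↪ Fin n) =>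
      ¬ Satisfiable (fun i => mkC (A i (sidx (A i)), F i)))]
    choose a b e hab hae hbe h1 h2 h3 using fun i : Fin m => choice3 hk (A i (sidx (A i)))
    refine (unifProb_mono (fun F hF => mt (good_sat _ a b e h1 h2 h3 F) hF)).trans ?_
    rw [unifProb_eq]
    have hE : (0:ℝ) < (Fintype.card (Fin k ↪ Fin n) : ℝ) ^ m := by
      have : 0 < Fintype.card (Fin k ↪ Fin n) := Fintype.card_pos
      positivity
    have := hKn m k (fun i => decide (pc (A i (sidx (A i))) ≤ 1))
      (fun i => decide (3 ≤ pc (A i (sidx (A i))))) a b e hab hae hbe hmle ?_ ?_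
    · rw [Fintype.card_fun, Fintype.card_fin]
      push_cast
      rw [div_le_iff₀ hE]
      refine (le_trans ?_ this).trans ?_
      · exact le_of_eq (by congr!)
      · rw [mul_comm]
        gcongr
        exact le_abs_self K
    · refine le_trans (le_of_eq ?_) hA1
      congr 2
      ext i; simp [S1]
    · refine le_trans (le_of_eq ?_) hA2
      congr 2
      ext i; simp [S2]; omega
  · gcongr
    refine le_trans (unifProb_mono (Q := fun A : Fin m → Fin 5 → Fin k → Bool =>
      (b1 * m < ((univ.filter fun i => A i ∈ S1 k).card : ℝ)) ∨
      (b2 * m < ((univ.filter fun i => A i ∈ S2 k).card : ℝ))) ?_) ((unifProb_or _ _).trans ?_)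
    · intro A hA
      rcases not_and_or.mp hA with h | h
      · exact Or.inl (not_le.mp h)
      · exact Or.inr (not_le.mp h)
    · have hE : (0:ℝ) < (Fintype.card (Fin 5 → Fin k → Bool) : ℝ) ^ m := by
        have : 0 < Fintype.card (Fin 5 → Fin k → Bool) := Fintype.card_pos
        positivity
      have hcard : (Fintype.card (Fin m → Fin 5 → Fin k → Bool) : ℝ) =
          (Fintype.card (Fin 5 → Fin k → Bool) : ℝ) ^ m := by
        rw [Fintype.card_fun (α := Fin m), Fintype.card_fin]; push_cast; rfl
      refine add_le_add ?_ ?_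
      · rw [unifProb_eq, hcard, div_le_iff₀ hE, mul_comm (q1 ^ m)]
        exact le_trans (le_of_eq (by congr!)) (hc1 m)
      · rw [unifProb_eq, hcard, div_le_iff₀ hE, mul_comm (q2 ^ m)]
        exact le_trans (le_of_eq (by congr!)) (hc2 m)

end Sel

section Num

lemma S1_card (k d : ℕ) (h : (univ.filter fun s : Fin k → Bool => pc s ≤ 1).card = d) :
    (S1 k).card ≤ d ^ 5 := by
  have : S1 k ⊆ Fintype.piFinset (fun _ : Fin 5 => univ.filter fun s : Fin k → Bool => pc s ≤ 1) := by
    intro σ hσ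
    rw [Fintype.mem_piFinset]
    intro j
    exact mem_filter.mpr ⟨mem_univ _, sidx_le_one (mem_filter.mp hσ).2 j⟩
  refine (card_le_card this).trans ?_
  rw [Fintype.card_piFinset]
  simp [h]

lemma S2_card4 : (S2 4).card ≤ 6 * 16 ^ 4 + 5 * 11 * 16 ^ 3 := by
  let U : Finset (Fin 4 → Bool) := univ
  let Q2 : Finset (Fin 4 → Bool) := univ.filter fun s => pc s = 2
  let Q1 : Finset (Fin 4 → Bool) := univ.filter fun s => pc s ≤ 1
  let Q3 : Finset (Fin 4 → Bool) := univ.filter fun s => pc s ≤ 2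
  have hU : U.card = 16 := by decide
  have hQ2 : Q2.card = 6 := by decide
  have hQ1 : Q1.card = 5 := by decide
  have hQ3 : Q3.card = 11 := by decide
  have : S2 4 ⊆ Fintype.piFinset (![Q2, U, U, U, U]) ∪ Fintype.piFinset (![Q1, Q3, U, U, U]) := by
    intro σ hσ
    rw [mem_union, Fintype.mem_piFinset, Fintype.mem_piFinset]
    rcases sidx_two (mem_filter.mp hσ).2 with h | ⟨h, h'⟩
    · left; intro j; fin_cases j <;> simp [U, Q2, h]
    · right; intro j; fin_cases j <;> simp [U, Q1, Q3, h, h']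
  refine (card_le_card this).trans ((card_union_le _ _).trans ?_)
  rw [Fintype.card_piFinset, Fintype.card_piFinset]
  simp [Fin.prod_univ_succ, hU, hQ1, hQ2, hQ3]

lemma S2_card_le (k : ℕ) : ((S2 k).card : ℝ) < 1.01 * Fintype.card (Fin 5 → Fin k → Bool) := by
  have h1 : ((S2 k).card : ℝ) ≤ Fintype.card (Fin 5 → Fin k → Bool) := by
    exact_mod_cast card_le_univ _
  have h2 : (0:ℝ) < Fintype.card (Fin 5 → Fin k → Bool) := by
    exact_mod_cast Fintype.card_pos
  linarith

lemma num_mono {x y b1 b2 : ℝ} (hx : 0 < x) (hxy : x ≤ y) (h1 : 0 < b1) (h2 : 0 < b2)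
    (h : 4 * y ^ 2 * b1 * (b2 + 2 * y * b1) < 1) : 4 * x ^ 2 * b1 * (b2 + 2 * x * b1) < 1 := by
  refine lt_of_le_of_lt ?_ h
  have hy : 0 < y := hx.trans_le hxy
  gcongr

end Num

/-- For every integer `4 ≤ k ≤ 6`, the 5-clause Achlioptas rule `select` for random `k`-SAT
generates a formula that is satisfiable whp after `⌈2^k * ln 2 * n⌉` steps. -/
theorem achlioptas_ksat_delay_five_choices (k : ℕ) (hk4 : 4 ≤ k) (hk6 : k ≤ 6) :
    Tendsto (fun n : ℕ =>
        unifProb (fun A : Fin (⌈(2 : ℝ) ^ k * Real.log 2 * n⌉₊) → Fin 5 → Clause n k =>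
          Satisfiable (fun i => select (by norm_num) (A i))))
      atTop (nhds 1) := by
  have hl0 : 0 < Real.log 2 := Real.log_pos (by norm_num)
  have hl : Real.log 2 ≤ 0.6931471808 := Real.log_two_lt_d9.le
  have hc : 0 < (2:ℝ) ^ k * Real.log 2 := by positivity
  have hy : (2:ℝ) ^ k * Real.log 2 ≤ 2 ^ k * 0.6931471808 := by gcongr
  interval_cases k
  · refine core (b1 := 0.003) (b2 := 0.59) le_rfl hc (by norm_num) (by norm_num)
      (num_mono hc hy (by norm_num) (by norm_num) (by norm_num)) ?_ ?_
    · have h : ((S1 4).card : ℝ) ≤ ((5 ^ 5 : ℕ) : ℝ) := by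
        exact_mod_cast S1_card 4 5 (by decide)
      refine lt_of_le_of_lt h ?_
      simp only [Fintype.card_fun, Fintype.card_fin, Fintype.card_bool]
      norm_num
    · have h : ((S2 4).card : ℝ) ≤ ((6 * 16 ^ 4 + 5 * 11 * 16 ^ 3 : ℕ) : ℝ) := by
        exact_mod_cast S2_card4
      refine lt_of_le_of_lt h ?_
      simp only [Fintype.card_fun, Fintype.card_fin, Fintype.card_bool]
      norm_num
  · refine core (b1 := 0.0003) (b2 := 1.01) (by norm_num) hc (by norm_num) (by norm_num)
      (num_mono hc hy (by norm_num) (by norm_num) (by norm_num)) ?_ (S2_card_le _)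
    have h : ((S1 5).card : ℝ) ≤ ((6 ^ 5 : ℕ) : ℝ) := by
      exact_mod_cast S1_card 5 6 (by decide)
    refine lt_of_le_of_lt h ?_
    simp only [Fintype.card_fun, Fintype.card_fin, Fintype.card_bool]
    norm_num
  · refine core (b1 := 0.00002) (b2 := 1.01) (by norm_num) hc (by norm_num) (by norm_num)
      (num_mono hc hy (by norm_num) (by norm_num) (by norm_num)) ?_ (S2_card_le _)
    have h : ((S1 6).card : ℝ) ≤ ((7 ^ 5 : ℕ) : ℝ) := by
      exact_mod_cast S1_card 6 7 (by decide +kernel)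
    refine lt_of_le_of_lt h ?_
    simp only [Fintype.card_fun, Fintype.card_fin, Fintype.card_bool]
    norm_num
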